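/- For every i ∈ ℕ and every A ∈ ℤ*: det(0^{2i}, A) = (-1)^i · det(A), and Sub(0^{2i}, A) = (-1)^i · Sub(A). -/

import Mathlib

/-- The determinant of the matrix `-M(X)`, where `M(X)` is the intersection matrix of
the sequence `X` (diagonal `xᵢ`, `1` on the off-diagonals `|i-j| = 1`); `det(∅) = 1`. -/
def seqDet : List ℤ → ℤ
  | [] => 1
  | [x] => -x
  | x :: y :: l => -x * seqDet (y :: l) - seqDet l

/-- `det₁(x₁,…,xₙ) = det(x₂,…,xₙ)`, with `det₁(∅) = 0`. -/
def seqDet1 : List ℤ → ℤ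
  | [] => 0
  | _ :: l => seqDet l

theorem seqDet_zero_zero_cons (A : List ℤ) : seqDet (0 :: 0 :: A) = -seqDet A := by
  simp [seqDet]

theorem seqDet1_zero_zero_cons (A : List ℤ) :
    seqDet1 (0 :: 0 :: A) = -seqDet1 A := by
  cases A <;> simp [seqDet, seqDet1]

theorem seqDet_append_zero_zero (A : List ℤ) : seqDet (A ++ [0, 0]) = -seqDet A := by
  induction A using seqDet.induct with
  | case1 => simp [seqDet]
  | case2 x => simp [seqDet]
  | case3 x y l ih₁ ih₂ =>
    simp only [List.cons_append, seqDet] at ih₁ ih₂ ⊢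
    rw [ih₁, ih₂]
    ring

theorem seqDet1_append_zero_zero (A : List ℤ) : seqDet1 (A ++ [0, 0]) = -seqDet1 A := by
  cases A with
  | nil => simp [seqDet, seqDet1]
  | cons x l => exact seqDet_append_zero_zero l

/-- **Lemma.** `det(0^{2i}, A) = (-1)^i det(A)` and `Sub(0^{2i}, A) = (-1)^i Sub(A)`. -/
theorem det_sub_replicate_zero (i : ℕ) (A : List ℤ) :
    seqDet (List.replicate (2 * i) 0 ++ A) = (-1) ^ i * seqDet A ∧
    seqDet1 (List.replicate (2 * i) 0 ++ A) = (-1) ^ i * seqDet1 A ∧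
    seqDet1 (List.replicate (2 * i) 0 ++ A).reverse = (-1) ^ i * seqDet1 A.reverse := by
  induction i with
  | zero => simp
  | succ i ih =>
    obtain ⟨h, h₁, h₁'⟩ := ih
    have hrep : List.replicate (2 * (i + 1)) (0 : ℤ) ++ A =
        0 :: 0 :: (List.replicate (2 * i) 0 ++ A) := rfl
    have hrev : (0 :: 0 :: (List.replicate (2 * i) 0 ++ A)).reverse =
        (List.replicate (2 * i) 0 ++ A).reverse ++ [0, 0] := by
      simp only [List.reverse_cons, List.append_assoc, List.cons_append, List.nil_append]
    rw [hrep, hrev, seqDet_zero_zero_cons, seqDet1_zero_zero_cons, seqDet1_append_zero_zero,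
      h, h₁, h₁', pow_succ]
    refine ⟨?_, ?_, ?_⟩ <;> ring
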